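/- arXiv:2603.17256 — 6 statements merged into one kernel-verified Lean document; each statement's English description precedes it below -/
import Mathlib

section
/- Let k, l, r be positive integers and let X, Y ∈ ℝ^{(k+l)×r} be real matrices whose column spaces coincide (the range of v ↦ X·v equals the range of v ↦ Y·v). Write M(X), M(Y) ∈ ℝ^{k×r} for the submatrices of the first k rows and F(X), F(Y) ∈ ℝ^{l×r} for the submatrices of the last l rows. If M(X) has full column rank r, then M(Y) also has full column rank r, and for every b ∈ ℝ^k the subspace predictions coincide: F(X)·(M(X)ᵀM(X))⁻¹·M(X)ᵀ·b = F(Y)·(M(Y)ᵀM(Y))⁻¹·M(Y)ᵀ·b. -/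
open Matrix BigOperators

/-- Euclidean norm of a real vector. -/
noncomputable def euclNorm {ι : Type*} [Fintype ι] (v : ι → ℝ) : ℝ :=
  Real.sqrt (∑ i, (v i) ^ 2)

/-- Moore–Penrose pseudoinverse of a full-column-rank matrix: M† = (MᵀM)⁻¹Mᵀ. -/
noncomputable def pinv {ι κ : Type*} [Fintype ι] [Fintype κ] [DecidableEq κ]
    (M : Matrix ι κ ℝ) : Matrix κ ι ℝ :=
  (Mᵀ * M)⁻¹ * Mᵀ

/-- If the range of `A` is contained in that of `B`, then `A` factors through `B`. -/
theorem exists_eq_mul_of_range_mulVecLin_le {R m n o : Type*} [CommSemiring R]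
    [Fintype n] [Fintype o] {A : Matrix m n R} {B : Matrix m o R}
    (h : LinearMap.range A.mulVecLin ≤ LinearMap.range B.mulVecLin) :
    ∃ C : Matrix o n R, A = B * C := by
  classical
  have hcol (j : n) : ∃ v : o → R, B *ᵥ v = A.col j := by
    obtain ⟨v, hv⟩ := h ⟨Pi.single j 1, rfl⟩
    exact ⟨v, by simpa using hv⟩
  choose C hC using hcol
  refine ⟨(of C)ᵀ, ?_⟩
  ext i j
  exact (congrFun (hC j) i).symm

theorem isUnit_of_rank_eq_card {K n : Type*} [Field K] [Fintype n] [DecidableEq n]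
    {A : Matrix n n K} (h : A.rank = Fintype.card n) : IsUnit A := by
  rw [← mulVec_surjective_iff_isUnit]
  suffices LinearMap.range A.mulVecLin = ⊤ from LinearMap.range_eq_top.1 this
  apply Submodule.eq_top_of_finrank_eq
  rw [Module.finrank_fintype_fun_eq_card]
  exact h

theorem pinv_mul_of_isUnit {ι κ : Type*} [Fintype ι] [Fintype κ] [DecidableEq κ]
    (M : Matrix ι κ ℝ) {C : Matrix κ κ ℝ} (hC : IsUnit C) : pinv (M * C) = C⁻¹ * pinv M := by
  have hCt : IsUnit Cᵀ.det := by rwa [det_transpose, ← isUnit_iff_isUnit_det]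
  have hgram : (M * C)ᵀ * (M * C) = Cᵀ * (Mᵀ * M * C) := by
    simp only [transpose_mul, Matrix.mul_assoc]
  rw [pinv, pinv, hgram, Matrix.mul_inv_rev, Matrix.mul_inv_rev, transpose_mul]
  simp only [Matrix.mul_assoc, nonsing_inv_mul_cancel_left _ _ hCt]

/-- Theorem 2 of the paper: the subspace predictor is representation-free.
If `X, Y ∈ ℝ^{(k+l)×r}` have the same column space and the first-`k`-rows submatrix of `X`
has full column rank `r`, then so does that of `Y`, and the subspace predictions coincide. -/
theorem subspace_predictor_representation_free
    (k l r : ℕ) (hk : 0 < k) (hl : 0 < l) (hr : 0 < r)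
    (X Y : Matrix (Fin (k + l)) (Fin r) ℝ)
    (hrange : LinearMap.range X.mulVecLin = LinearMap.range Y.mulVecLin)
    (hMX : (X.submatrix (Fin.castAdd l) id).rank = r) :
    (Y.submatrix (Fin.castAdd l) id).rank = r ∧
    ∀ b : Fin k → ℝ,
      ((X.submatrix (Fin.natAdd k) id) * pinv (X.submatrix (Fin.castAdd l) id)).mulVec b =
      ((Y.submatrix (Fin.natAdd k) id) * pinv (Y.submatrix (Fin.castAdd l) id)).mulVec b := by
  obtain ⟨C, rfl⟩ := exists_eq_mul_of_range_mulVecLin_le hrange.le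
  have hsub {m : ℕ} (f : Fin m → Fin (k + l)) :
      (Y * C).submatrix f id = Y.submatrix f id * C := by
    rw [← submatrix_mul_equiv Y C f (Equiv.refl _) id]
    simp
  rw [hsub] at hMX
  have hC : IsUnit C := isUnit_of_rank_eq_card <| by
    rw [Fintype.card_fin]
    exact (rank_le_width C).antisymm (hMX.ge.trans (rank_mul_le_right _ _))
  refine ⟨(rank_le_width _).antisymm (hMX.ge.trans (rank_mul_le_left _ _)), fun b => ?_⟩
  rw [hsub, hsub, pinv_mul_of_isUnit _ hC, Matrix.mul_assoc,
    mul_nonsing_inv_cancel_left _ _ ((isUnit_iff_isUnit_det C).1 hC)]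
end

section
/- Let n, m, p be positive integers, T_ini ≥ n, T_f ≥ 1, and set L = T_ini + T_f, q = (m+p)L, r = n + mL, k = mL + p·T_ini, l = p·T_f. Let A ∈ ℝ^{n×n}, B ∈ ℝ^{n×m}, C ∈ ℝ^{p×n}, D ∈ ℝ^{p×m} with trajectory generation matrices Φ_{T_ini} and Φ_L. Assume there exist β > 0 with ‖Φ_{T_ini}·z‖₂ ≥ β·‖z‖₂ for all z ∈ ℝ^{n+m·T_ini}, and α > 0 with ‖Φ_L‖₂ ≤ α; set γ = min(1, β)/α. Let U ∈ ℝ^{q×r} have orthonormal columns with column space equal to the column space of Φ_L, and let Û ∈ ℝ^{q×r} have orthonormal columns. Write M, M̂ ∈ ℝ^{k×r} for the first k rows of U, Û and Y_f, Ŷ_f ∈ ℝ^{l×r} for the last l rows. If κ := (1/√2)·‖UUᵀ − ÛÛᵀ‖_F ≤ γ/(2√2), then M and M̂ have full column rank and for every b ∈ ℝ^k: ‖Ŷ_f·M̂†·b − Y_f·M†·b‖₂ ≤ (2(1+√5)/γ² + 1/γ)·√2·κ·‖b‖₂. -/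
open Matrix BigOperators

/-- Frobenius norm of a real matrix. -/
noncomputable def frobNorm {ι κ : Type*} [Fintype ι] [Fintype κ] (M : Matrix ι κ ℝ) : ℝ :=
  Real.sqrt (∑ i, ∑ j, (M i j) ^ 2)

/-- Spectral (ℓ²-operator) norm of a real matrix. -/
noncomputable def specNorm {ι κ : Type*} [Fintype ι] [Fintype κ] (M : Matrix ι κ ℝ) : ℝ :=
  sSup {c | ∃ x : κ → ℝ, euclNorm x = 1 ∧ c = euclNorm (M.mulVec x)}

/-- Extended observability matrix `O_L`: `i`-th block row is `C·Aⁱ`. -/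
noncomputable def obsMat {n p : ℕ} (A : Matrix (Fin n) (Fin n) ℝ)
    (C : Matrix (Fin p) (Fin n) ℝ) (L : ℕ) : Matrix (Fin L × Fin p) (Fin n) ℝ :=
  fun ip j => (C * A ^ (ip.1 : ℕ)) ip.2 j

/-- Block lower-triangular Toeplitz matrix `T_L`: `(i,j)` block is `D` if `i = j`,
`C·A^{i−j−1}·B` if `i > j`, and `0` if `i < j`. -/
noncomputable def toepMat {n m p : ℕ} (A : Matrix (Fin n) (Fin n) ℝ)
    (B : Matrix (Fin n) (Fin m) ℝ) (C : Matrix (Fin p) (Fin n) ℝ)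
    (D : Matrix (Fin p) (Fin m) ℝ) (L : ℕ) :
    Matrix (Fin L × Fin p) (Fin L × Fin m) ℝ :=
  fun ip jq =>
    if (ip.1 : ℕ) = (jq.1 : ℕ) then D ip.2 jq.2
    else if (jq.1 : ℕ) < (ip.1 : ℕ) then (C * A ^ ((ip.1 : ℕ) - (jq.1 : ℕ) - 1) * B) ip.2 jq.2
    else 0

/-- Trajectory generation matrix `Φ_L = [[0, I], [O_L, T_L]]`, with rows indexed by the
stacked inputs `(Fin L × Fin m)` followed by the stacked outputs `(Fin L × Fin p)`, and
columns indexed by the initial state `Fin n` followed by the stacked inputs. -/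
noncomputable def phiMat {n m p : ℕ} (A : Matrix (Fin n) (Fin n) ℝ)
    (B : Matrix (Fin n) (Fin m) ℝ) (C : Matrix (Fin p) (Fin n) ℝ)
    (D : Matrix (Fin p) (Fin m) ℝ) (L : ℕ) :
    Matrix ((Fin L × Fin m) ⊕ (Fin L × Fin p)) ((Fin n) ⊕ (Fin L × Fin m)) ℝ :=
  Matrix.fromBlocks 0 1 (obsMat A C L) (toepMat A B C D L)

/-- Row selection embedding picking, out of the stacked rows
`(inputs over [0, T_ini+T_f)) ⊕ (outputs over [0, T_ini+T_f))`, all input rows together with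
the past output rows (time indices `< T_ini`): these are the "first `k = mL + p·T_ini` rows". -/
def pastRows (Tini Tf m p : ℕ) :
    ((Fin (Tini + Tf) × Fin m) ⊕ (Fin Tini × Fin p)) →
      ((Fin (Tini + Tf) × Fin m) ⊕ (Fin (Tini + Tf) × Fin p)) :=
  Sum.map id (fun tp => (Fin.castAdd Tf tp.1, tp.2))

/-- Row selection embedding picking the future output rows (time indices in
`[T_ini, T_ini+T_f)`): these are the "last `l = p·T_f` rows". -/
def futureRows (Tini Tf m p : ℕ) :
    (Fin Tf × Fin p) → ((Fin (Tini + Tf) × Fin m) ⊕ (Fin (Tini + Tf) × Fin p)) :=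
  fun tp => Sum.inr (Fin.natAdd Tini tp.1, tp.2)

/-- Perturbation bound for least-squares predictors `b ↦ Y x`, where `x` minimises `‖M x - b‖`:
the data `(M, Y)` and `(Mh, Yh)` agree up to `ε` after the changes of coordinates `W`, `V`. -/
theorem leastSquares_perturbation {X K H : Type*}
    [NormedAddCommGroup X] [InnerProductSpace ℝ X] [NormedAddCommGroup K] [InnerProductSpace ℝ K]
    [NormedAddCommGroup H] [InnerProductSpace ℝ H]
    {M Mh : X →ₗ[ℝ] K} {Y Yh : X →ₗ[ℝ] H} {W V : X →ₗ[ℝ] X} {γ ε : ℝ}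
    (hγ : 0 < γ) (hγ1 : γ ≤ 1) (hε : 0 ≤ ε)
    (hM : ∀ x, γ * ‖x‖ ≤ ‖M x‖) (hMh : ∀ x, γ / 3 * ‖x‖ ≤ ‖Mh x‖) (hY : ∀ x, ‖Y x‖ ≤ ‖x‖)
    (hMW : ∀ x, ‖Mh x - M (W x)‖ ≤ ε * ‖x‖) (hYW : ∀ x, ‖Yh x - Y (W x)‖ ≤ ε * ‖x‖)
    (hMV : ∀ x, ‖M x - Mh (V x)‖ ≤ ε * ‖x‖)
    {b : K} {x xh : X} (hx : ∀ z, inner ℝ (M z) (M x - b) = 0)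
    (hxh : ∀ z, inner ℝ (Mh z) (Mh xh - b) = 0) :
    ‖Yh xh - Y x‖ ≤ (6 / γ ^ 2 + 1 / γ) * ε * ‖b‖ := by
  have pyth : ‖b‖ ^ 2 = ‖Mh xh‖ ^ 2 + ‖Mh xh - b‖ ^ 2 := by
    have h := hxh xh
    have h2 := norm_sub_sq_real (Mh xh) (Mh xh - b)
    rw [h, sub_sub_cancel] at h2
    linarith
  have hres : ‖Mh xh - b‖ ≤ ‖b‖ := by
    refine le_of_sq_le_sq ?_ (norm_nonneg b)
    nlinarith [sq_nonneg ‖Mh xh‖]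
  have hfit : ‖Mh xh‖ ≤ ‖b‖ := by
    refine le_of_sq_le_sq ?_ (norm_nonneg b)
    nlinarith [sq_nonneg ‖Mh xh - b‖]
  have hxhb : ‖xh‖ ≤ 3 / γ * ‖b‖ := by
    rw [div_mul_eq_mul_div, le_div_iff₀ hγ]
    linarith [hMh xh]
  set d := W xh - x with hd
  have hdM : ‖d‖ ≤ ‖M d‖ / γ := by
    rw [le_div_iff₀ hγ]
    linarith [hM d]
  have hsq : ‖M d‖ ^ 2 = inner ℝ (M d - Mh (V d)) (Mh xh - b)
      - inner ℝ (M d) (Mh xh - M (W xh)) := by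
    have hMd : M d = (Mh xh - b) - (Mh xh - M (W xh)) - (M x - b) := by
      rw [hd, map_sub]; abel
    rw [← real_inner_self_eq_norm_sq]
    conv_lhs => rw [show inner ℝ (M d) (M d) =
      inner ℝ (M d) ((Mh xh - b) - (Mh xh - M (W xh)) - (M x - b)) by rw [← hMd]]
    rw [inner_sub_right, inner_sub_right, hx d, inner_sub_left (M d), hxh (V d)]
    ring
  have hMd : ‖M d‖ ≤ 4 * ε / γ * ‖b‖ := by
    have h1 : inner ℝ (M d - Mh (V d)) (Mh xh - b) ≤ (ε * (‖M d‖ / γ)) * ‖b‖ :=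
      (real_inner_le_norm _ _).trans (mul_le_mul ((hMV d).trans (by gcongr)) hres
        (norm_nonneg _) (by positivity))
    have h2 : -inner ℝ (M d) (Mh xh - M (W xh)) ≤ ‖M d‖ * (ε * (3 / γ * ‖b‖)) :=
      (neg_le_abs _).trans ((abs_real_inner_le_norm _ _).trans
        (mul_le_mul_of_nonneg_left ((hMW xh).trans (by gcongr)) (norm_nonneg _)))
    have h3 : ‖M d‖ * ‖M d‖ ≤ ‖M d‖ * (4 * ε / γ * ‖b‖) := by
      calc ‖M d‖ * ‖M d‖ = ‖M d‖ ^ 2 := (sq _).symm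
        _ ≤ (ε * (‖M d‖ / γ)) * ‖b‖ + ‖M d‖ * (ε * (3 / γ * ‖b‖)) := by linarith
        _ = _ := by ring
    rcases (norm_nonneg (M d)).eq_or_lt with h0 | h0
    · rw [← h0]; positivity
    · exact le_of_mul_le_mul_left h3 h0
  have hsplit : Yh xh - Y x = (Yh xh - Y (W xh)) + Y d := by
    rw [hd, map_sub]; abel
  have hγ2 : 1 / γ ≤ 1 / γ ^ 2 := by
    apply one_div_le_one_div_of_le (by positivity)
    nlinarith
  calc ‖Yh xh - Y x‖ ≤ ‖Yh xh - Y (W xh)‖ + ‖Y d‖ := hsplit ▸ norm_add_le _ _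
    _ ≤ ε * (3 / γ * ‖b‖) + (4 * ε / γ * ‖b‖) / γ := by
        apply add_le_add ((hYW xh).trans (by gcongr))
        exact (hY d).trans (hdM.trans (by gcongr))
    _ = (4 * (1 / γ ^ 2) + 3 * (1 / γ)) * (ε * ‖b‖) := by ring
    _ ≤ (6 * (1 / γ ^ 2) + 1 / γ) * (ε * ‖b‖) := by
        apply mul_le_mul_of_nonneg_right _ (by positivity)
        linarith
    _ = _ := by ring

theorem rank_eq_card_of_mulVec_injective {ι κ : Type*} [Fintype κ] {M : Matrix ι κ ℝ}
    (hM : Function.Injective M.mulVec) :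
    M.rank = Fintype.card κ := by
  rw [Matrix.rank, LinearMap.finrank_range_of_inj (f := M.mulVecLin) hM,
    Module.finrank_fintype_fun_eq_card]

section Euclidean

variable {ι κ : Type*} [Fintype ι] [Fintype κ]

theorem euclNorm_eq_norm (v : ι → ℝ) : euclNorm v = ‖WithLp.toLp 2 v‖ := by
  simp [euclNorm, EuclideanSpace.norm_eq]

theorem euclNorm_nonneg (v : ι → ℝ) : 0 ≤ euclNorm v := Real.sqrt_nonneg _

theorem euclNorm_sq (v : ι → ℝ) : euclNorm v ^ 2 = ∑ i, v i ^ 2 :=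
  Real.sq_sqrt (Finset.sum_nonneg fun _ _ => sq_nonneg _)

theorem euclNorm_sq_eq_dotProduct (v : ι → ℝ) : euclNorm v ^ 2 = v ⬝ᵥ v := by
  rw [euclNorm_sq]
  exact Finset.sum_congr rfl fun i _ => sq (v i)

theorem euclNorm_smul (c : ℝ) (v : ι → ℝ) : euclNorm (c • v) = |c| * euclNorm v := by
  simp [euclNorm_eq_norm, norm_smul]

theorem euclNorm_comp_le {f : κ → ι} (hf : Function.Injective f) (v : ι → ℝ) :
    euclNorm (v ∘ f) ≤ euclNorm v := by
  apply Real.sqrt_le_sqrt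
  calc ∑ i, (v ∘ f) i ^ 2 = ∑ i ∈ Finset.univ.map ⟨f, hf⟩, v i ^ 2 := by simp
    _ ≤ ∑ i, v i ^ 2 := Finset.sum_le_univ_sum_of_nonneg fun _ => sq_nonneg _

theorem euclNorm_mulVec_le_frobNorm (N : Matrix ι κ ℝ) (v : κ → ℝ) :
    euclNorm (N *ᵥ v) ≤ frobNorm N * euclNorm v := by
  have h0 : 0 ≤ ∑ i, ∑ j, N i j ^ 2 :=
    Finset.sum_nonneg fun _ _ => Finset.sum_nonneg fun _ _ => sq_nonneg _
  refine (Real.sqrt_le_sqrt ?_).trans_eq (Real.sqrt_mul h0 _)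
  rw [Finset.sum_mul]
  exact Finset.sum_le_sum fun i _ => Finset.sum_mul_sq_le_sq_mul_sq _ _ _

theorem euclNorm_mulVec_le_specNorm (N : Matrix ι κ ℝ) (v : κ → ℝ) :
    euclNorm (N *ᵥ v) ≤ specNorm N * euclNorm v := by
  have hbdd : BddAbove {c | ∃ x : κ → ℝ, euclNorm x = 1 ∧ c = euclNorm (N.mulVec x)} := by
    refine ⟨frobNorm N, ?_⟩
    rintro _ ⟨x, hx, rfl⟩
    simpa [hx] using euclNorm_mulVec_le_frobNorm N x
  rcases (euclNorm_nonneg v).eq_or_lt with h0 | h0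
  · have h := euclNorm_mulVec_le_frobNorm N v
    rw [← h0, mul_zero] at h ⊢
    exact h
  · have h := le_csSup hbdd ⟨(euclNorm v)⁻¹ • v, by
      rw [euclNorm_smul, abs_of_pos (inv_pos.2 h0), inv_mul_cancel₀ h0.ne'], rfl⟩
    rw [mulVec_smul, euclNorm_smul, abs_of_pos (inv_pos.2 h0), inv_mul_le_iff₀ h0] at h
    rw [mul_comm]
    exact h

theorem euclNorm_mulVec_of_orthonormal [DecidableEq κ] {U : Matrix ι κ ℝ} (hU : Uᵀ * U = 1) (x : κ → ℝ) :
    euclNorm (U *ᵥ x) = euclNorm x := by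
  rw [← sq_eq_sq₀ (euclNorm_nonneg _) (euclNorm_nonneg _), euclNorm_sq_eq_dotProduct,
    euclNorm_sq_eq_dotProduct, dotProduct_mulVec, ← mulVec_transpose, mulVec_mulVec, hU,
    one_mulVec]

theorem mulVec_injective_of_le {M : Matrix ι κ ℝ} {c : ℝ} (hc : 0 < c)
    (hM : ∀ x, c * euclNorm x ≤ euclNorm (M *ᵥ x)) : Function.Injective M.mulVec := by
  change Function.Injective M.mulVecLin
  rw [injective_iff_map_eq_zero]
  intro x hx
  have h := hM x
  rw [mulVecLin_apply] at hx
  rw [hx, euclNorm_eq_norm, euclNorm_eq_norm, WithLp.toLp_zero, norm_zero] at h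
  have h' : ‖WithLp.toLp 2 x‖ = 0 := le_antisymm (by nlinarith) (norm_nonneg _)
  simpa using h'

theorem transpose_mul_mul_pinv [DecidableEq κ] {M : Matrix ι κ ℝ} (hM : Function.Injective M.mulVec) :
    Mᵀ * (M * pinv M) = Mᵀ := by
  have hinj : Function.Injective (Mᵀ * M).mulVec := by
    change Function.Injective (Mᵀ * M).mulVecLin
    rw [← LinearMap.ker_eq_bot, Matrix.ker_mulVecLin_transpose_mul_self, LinearMap.ker_eq_bot]
    exact hM
  have hunit := (Matrix.isUnit_iff_isUnit_det _).1 (Matrix.mulVec_injective_iff_isUnit.1 hinj)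
  rw [pinv, ← Matrix.mul_assoc, ← Matrix.mul_assoc, Matrix.mul_nonsing_inv _ hunit,
    Matrix.one_mul]

theorem dotProduct_residual_pinv [DecidableEq κ] {M : Matrix ι κ ℝ} (hM : Function.Injective M.mulVec)
    (b : ι → ℝ) (z : κ → ℝ) : (M *ᵥ z) ⬝ᵥ (M *ᵥ (pinv M *ᵥ b) - b) = 0 := by
  rw [dotProduct_comm, dotProduct_mulVec, ← mulVec_transpose, mulVec_sub, mulVec_mulVec, mulVec_mulVec,
    Matrix.mul_assoc, transpose_mul_mul_pinv hM, sub_self, zero_dotProduct]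

theorem euclNorm_mulVec_sub_le [DecidableEq κ] {U Uh : Matrix ι κ ℝ} (hUh : Uhᵀ * Uh = 1) (x : κ → ℝ) :
    euclNorm (Uh *ᵥ x - U *ᵥ ((Uᵀ * Uh) *ᵥ x)) ≤ frobNorm (U * Uᵀ - Uh * Uhᵀ) * euclNorm x := by
  have h : Uh *ᵥ x - U *ᵥ ((Uᵀ * Uh) *ᵥ x) = -((U * Uᵀ - Uh * Uhᵀ) *ᵥ (Uh *ᵥ x)) := by
    rw [sub_mulVec, neg_sub, mulVec_mulVec, mulVec_mulVec, mulVec_mulVec, Matrix.mul_assoc Uh,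
      hUh, Matrix.mul_one, Matrix.mul_assoc]
  rw [h, ← neg_one_smul ℝ, euclNorm_smul, abs_neg, abs_one, one_mul,
    ← euclNorm_mulVec_of_orthonormal hUh x]
  exact euclNorm_mulVec_le_frobNorm _ _

theorem euclNorm_sq_eq_projection [DecidableEq κ] {U Uh : Matrix ι κ ℝ} (hU : Uᵀ * U = 1) (hUh : Uhᵀ * Uh = 1)
    (x : κ → ℝ) :
    euclNorm x ^ 2 = euclNorm ((Uᵀ * Uh) *ᵥ x) ^ 2
      + euclNorm (Uh *ᵥ x - U *ᵥ ((Uᵀ * Uh) *ᵥ x)) ^ 2 := by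
  have h1 : (Uh *ᵥ x) ⬝ᵥ (U *ᵥ ((Uᵀ * Uh) *ᵥ x)) = euclNorm ((Uᵀ * Uh) *ᵥ x) ^ 2 := by
    rw [dotProduct_mulVec, ← mulVec_transpose, mulVec_mulVec, euclNorm_sq_eq_dotProduct]
  have h2 := euclNorm_mulVec_of_orthonormal hU ((Uᵀ * Uh) *ᵥ x)
  have h3 := euclNorm_mulVec_of_orthonormal hUh x
  rw [euclNorm_sq_eq_dotProduct (_ - _), sub_dotProduct, dotProduct_sub, dotProduct_sub,
    dotProduct_comm (U *ᵥ _) (Uh *ᵥ x), h1, ← euclNorm_sq_eq_dotProduct,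
    ← euclNorm_sq_eq_dotProduct, h2, h3]
  ring

/-- The least-squares predictor built from selected rows of an orthonormal basis `U` depends
Lipschitz continuously on the projection `U * Uᵀ`. -/
theorem predictor_perturbation {ρ σ : Type*} [Fintype ρ] [Fintype σ] [DecidableEq κ] [Nonempty κ]
    {f : ρ → ι} {g : σ → ι} (hf : Function.Injective f) (hg : Function.Injective g)
    {U Uh : Matrix ι κ ℝ} (hU : Uᵀ * U = 1) (hUh : Uhᵀ * Uh = 1) {γ : ℝ} (hγ : 0 < γ)
    (hM : ∀ x, γ * euclNorm x ≤ euclNorm (U.submatrix f id *ᵥ x))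
    (hε : frobNorm (U * Uᵀ - Uh * Uhᵀ) ≤ γ / 2) :
    (U.submatrix f id).rank = Fintype.card κ ∧ (Uh.submatrix f id).rank = Fintype.card κ ∧
    ∀ b : ρ → ℝ,
      euclNorm ((Uh.submatrix g id * pinv (Uh.submatrix f id)) *ᵥ b -
        (U.submatrix g id * pinv (U.submatrix f id)) *ᵥ b)
      ≤ (6 / γ ^ 2 + 1 / γ) * frobNorm (U * Uᵀ - Uh * Uhᵀ) * euclNorm b := by
  set ε := frobNorm (U * Uᵀ - Uh * Uhᵀ) with hεdef
  have hε0 : 0 ≤ ε := Real.sqrt_nonneg _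
  have hsymm : frobNorm (Uh * Uhᵀ - U * Uᵀ) = ε := by
    rw [hεdef, frobNorm, frobNorm]
    congr 1
    exact Finset.sum_congr rfl fun i _ => Finset.sum_congr rfl fun j _ => by
      simp only [Matrix.sub_apply]; ring
  have hγ1 : γ ≤ 1 := by
    have h1 := hM 1
    have h2 := (euclNorm_comp_le hf (U *ᵥ 1)).trans_eq (euclNorm_mulVec_of_orthonormal hU 1)
    have h3 : 0 < euclNorm (1 : κ → ℝ) := by
      simp [euclNorm, Fintype.card_pos]
    have h4 := h1.trans h2
    nlinarith
  have hE (x : κ → ℝ) :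
      euclNorm (Uh.submatrix f id *ᵥ x - U.submatrix f id *ᵥ ((Uᵀ * Uh) *ᵥ x))
        ≤ ε * euclNorm x :=
    (euclNorm_comp_le hf _).trans (euclNorm_mulVec_sub_le hUh x)
  have hEg (x : κ → ℝ) :
      euclNorm (Uh.submatrix g id *ᵥ x - U.submatrix g id *ᵥ ((Uᵀ * Uh) *ᵥ x))
        ≤ ε * euclNorm x :=
    (euclNorm_comp_le hg _).trans (euclNorm_mulVec_sub_le hUh x)
  have hF (x : κ → ℝ) :
      euclNorm (U.submatrix f id *ᵥ x - Uh.submatrix f id *ᵥ ((Uhᵀ * U) *ᵥ x))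
        ≤ ε * euclNorm x :=
    (euclNorm_comp_le hf _).trans ((euclNorm_mulVec_sub_le hU x).trans_eq (by rw [hsymm]))
  have hMh (x : κ → ℝ) : γ / 3 * euclNorm x ≤ euclNorm (Uh.submatrix f id *ᵥ x) := by
    have hx0 := euclNorm_nonneg x
    have hW : 5 / 6 * euclNorm x ≤ euclNorm ((Uᵀ * Uh) *ᵥ x) := by
      refine le_of_sq_le_sq ?_ (euclNorm_nonneg _)
      have h1 := euclNorm_sq_eq_projection hU hUh x
      have h2 : euclNorm (Uh *ᵥ x - U *ᵥ ((Uᵀ * Uh) *ᵥ x)) ^ 2 ≤ (1 / 2 * euclNorm x) ^ 2 := by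
        apply pow_le_pow_left₀ (euclNorm_nonneg _)
        exact (euclNorm_mulVec_sub_le hUh x).trans
          (mul_le_mul_of_nonneg_right (by linarith) hx0)
      nlinarith [sq_nonneg (euclNorm x)]
    have htri : euclNorm (U.submatrix f id *ᵥ ((Uᵀ * Uh) *ᵥ x)) ≤
        euclNorm (Uh.submatrix f id *ᵥ x) +
        euclNorm (Uh.submatrix f id *ᵥ x - U.submatrix f id *ᵥ ((Uᵀ * Uh) *ᵥ x)) := by
      simp only [euclNorm_eq_norm, WithLp.toLp_sub]
      exact norm_le_norm_add_norm_sub _ _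
    have h1 := hM ((Uᵀ * Uh) *ᵥ x)
    have h2 := hE x
    have h3 : ε * euclNorm x ≤ γ / 2 * euclNorm x := mul_le_mul_of_nonneg_right hε hx0
    have h4 := mul_le_mul_of_nonneg_left hW hγ.le
    linarith
  have hinj := mulVec_injective_of_le hγ hM
  have hinjh := mulVec_injective_of_le (by positivity) hMh
  refine ⟨rank_eq_card_of_mulVec_injective hinj, rank_eq_card_of_mulVec_injective hinjh,
    fun b => ?_⟩
  have key := leastSquares_perturbation
    (M := (U.submatrix f id).toEuclideanLin) (Mh := (Uh.submatrix f id).toEuclideanLin)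
    (Y := (U.submatrix g id).toEuclideanLin) (Yh := (Uh.submatrix g id).toEuclideanLin)
    (W := (Uᵀ * Uh).toEuclideanLin) (V := (Uhᵀ * U).toEuclideanLin) hγ hγ1 hε0
    (fun x => by simpa [euclNorm_eq_norm, toLpLin_apply] using hM x.ofLp)
    (fun x => by simpa [euclNorm_eq_norm, toLpLin_apply] using hMh x.ofLp)
    (fun x => by
      simpa [euclNorm_eq_norm, toLpLin_apply] using
        show euclNorm (U.submatrix g id *ᵥ x.ofLp) ≤ _ from
          (euclNorm_comp_le hg (U *ᵥ x.ofLp)).trans_eq (euclNorm_mulVec_of_orthonormal hU x.ofLp))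
    (fun x => by simpa [euclNorm_eq_norm, toLpLin_apply] using hE x.ofLp)
    (fun x => by simpa [euclNorm_eq_norm, toLpLin_apply] using hEg x.ofLp)
    (fun x => by simpa [euclNorm_eq_norm, toLpLin_apply] using hF x.ofLp)
    (b := WithLp.toLp 2 b) (x := WithLp.toLp 2 (pinv (U.submatrix f id) *ᵥ b))
    (xh := WithLp.toLp 2 (pinv (Uh.submatrix f id) *ᵥ b))
    (fun z => by
      rw [real_inner_comm]
      simpa [EuclideanSpace.inner_eq_star_dotProduct, toLpLin_apply] using
        dotProduct_residual_pinv hinj b z.ofLp)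
    (fun z => by
      rw [real_inner_comm]
      simpa [EuclideanSpace.inner_eq_star_dotProduct, toLpLin_apply] using
        dotProduct_residual_pinv hinjh b z.ofLp)
  simpa [euclNorm_eq_norm, mulVec_mulVec, toLpLin_apply] using key

end Euclidean

section Trajectories

variable {n m p Tini Tf : ℕ} (A : Matrix (Fin n) (Fin n) ℝ) (B : Matrix (Fin n) (Fin m) ℝ)
  (C : Matrix (Fin p) (Fin n) ℝ) (D : Matrix (Fin p) (Fin m) ℝ)

theorem pastRows_injective : Function.Injective (pastRows Tini Tf m p) := by
  apply Function.Injective.sumMap Function.injective_id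
  rintro ⟨a, b⟩ ⟨c, d⟩ h
  simpa using h

theorem futureRows_injective : Function.Injective (futureRows Tini Tf m p) := by
  rintro ⟨a, b⟩ ⟨c, d⟩ h
  simpa [futureRows] using h

theorem phiMat_mulVec_inl (L : ℕ) (z : Fin n ⊕ (Fin L × Fin m) → ℝ) (i : Fin L × Fin m) :
    (phiMat A B C D L *ᵥ z) (Sum.inl i) = z (Sum.inr i) := by
  simp [phiMat, fromBlocks_mulVec]

/-- Past outputs depend only on the initial state and the past inputs. -/
theorem phiMat_mulVec_past (z : Fin n ⊕ (Fin (Tini + Tf) × Fin m) → ℝ) (t : Fin Tini × Fin p) :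
    (phiMat A B C D (Tini + Tf) *ᵥ z) (Sum.inr (Fin.castAdd Tf t.1, t.2)) =
      (phiMat A B C D Tini *ᵥ (z ∘ Sum.map id fun s => (Fin.castAdd Tf s.1, s.2)))
        (Sum.inr t) := by
  have hfut (i : Fin Tf) : (t.1 : ℕ) ≠ Tini + i ∧ ¬ Tini + (i : ℕ) < t.1 := by
    have := t.1.isLt
    omega
  simp [phiMat, mulVec, dotProduct, Fintype.sum_sum_type, Fintype.sum_prod_type,
    Fin.sum_univ_add, obsMat, toepMat, hfut]

theorem le_euclNorm_phiMat_past {β : ℝ} (hβ : 0 < β)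
    (hβbound : ∀ z : (Fin n ⊕ (Fin Tini × Fin m)) → ℝ,
      β * euclNorm z ≤ euclNorm ((phiMat A B C D Tini).mulVec z))
    (z : Fin n ⊕ (Fin (Tini + Tf) × Fin m) → ℝ) :
    min 1 β * euclNorm z ≤
      euclNorm ((phiMat A B C D (Tini + Tf) *ᵥ z) ∘ pastRows Tini Tf m p) := by
  set z' : Fin n ⊕ (Fin Tini × Fin m) → ℝ :=
    z ∘ Sum.map id fun s => (Fin.castAdd Tf s.1, s.2) with hz'
  set u := ∑ i : Fin Tf, ∑ j : Fin m, z (Sum.inr (Fin.natAdd Tini i, j)) ^ 2 with hu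
  have hu0 : 0 ≤ u := Finset.sum_nonneg fun _ _ => Finset.sum_nonneg fun _ _ => sq_nonneg _
  have hμ : 0 < min 1 β := lt_min one_pos hβ
  have hz : euclNorm z ^ 2 = euclNorm z' ^ 2 + u := by
    simp only [euclNorm_sq, Fintype.sum_sum_type, Fintype.sum_prod_type, Fin.sum_univ_add, hz', hu,
      Function.comp_apply, Sum.map_inl, Sum.map_inr, id_eq]
    ring
  have hpast : euclNorm ((phiMat A B C D (Tini + Tf) *ᵥ z) ∘ pastRows Tini Tf m p) ^ 2 =
      euclNorm (phiMat A B C D Tini *ᵥ z') ^ 2 + u := by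
    simp only [euclNorm_sq, Fintype.sum_sum_type, Function.comp_apply, pastRows, Sum.map_inl,
      Sum.map_inr, id_eq, phiMat_mulVec_past, phiMat_mulVec_inl]
    simp only [Fintype.sum_prod_type, Fin.sum_univ_add, hz', hu,
      Function.comp_apply, Sum.map_inr]
    ring
  refine le_of_sq_le_sq ?_ (euclNorm_nonneg _)
  have h1 : (min 1 β * euclNorm z') ^ 2 ≤ euclNorm (phiMat A B C D Tini *ᵥ z') ^ 2 :=
    pow_le_pow_left₀ (mul_nonneg hμ.le (euclNorm_nonneg _))
      ((mul_le_mul_of_nonneg_right (min_le_right _ _) (euclNorm_nonneg _)).trans (hβbound z')) 2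
  have h2 : min 1 β ^ 2 * u ≤ u :=
    mul_le_of_le_one_left hu0 (pow_le_one₀ hμ.le (min_le_left _ _))
  rw [mul_pow, hz, hpast]
  rw [mul_pow] at h1
  linarith

end Trajectories

/-- Theorem 1 of the paper: local Lipschitz continuity of the subspace
predictor with respect to the chordal distance between the true restricted behavior
`im Φ_{T_ini+T_f} = im U` and an approximation `im Û`, with Lipschitz constant expressed
through the degree of observability `β` and the gain `α` via `γ = min(1, β)/α`. -/
theorem subspace_predictor_error_bound
    (n m p Tini Tf : ℕ) (hn : 0 < n) (hm : 0 < m) (hp : 0 < p)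
    (hTini : n ≤ Tini) (hTf : 1 ≤ Tf)
    (A : Matrix (Fin n) (Fin n) ℝ) (B : Matrix (Fin n) (Fin m) ℝ)
    (C : Matrix (Fin p) (Fin n) ℝ) (D : Matrix (Fin p) (Fin m) ℝ)
    (β α : ℝ) (hβ : 0 < β)
    (hβbound : ∀ z : (Fin n ⊕ (Fin Tini × Fin m)) → ℝ,
      β * euclNorm z ≤ euclNorm ((phiMat A B C D Tini).mulVec z))
    (hα : 0 < α) (hαbound : specNorm (phiMat A B C D (Tini + Tf)) ≤ α)
    (γ : ℝ) (hγ : γ = min 1 β / α)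
    (U Uh : Matrix ((Fin (Tini + Tf) × Fin m) ⊕ (Fin (Tini + Tf) × Fin p))
          (Fin (n + m * (Tini + Tf))) ℝ)
    (hUorth : Uᵀ * U = 1) (hUhorth : Uhᵀ * Uh = 1)
    (hUrange : LinearMap.range U.mulVecLin =
      LinearMap.range (phiMat A B C D (Tini + Tf)).mulVecLin)
    (κ : ℝ) (hκdef : κ = (1 / Real.sqrt 2) * frobNorm (U * Uᵀ - Uh * Uhᵀ))
    (hκ : κ ≤ γ / (2 * Real.sqrt 2)) :
    (U.submatrix (pastRows Tini Tf m p) id).rank = n + m * (Tini + Tf) ∧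
    (Uh.submatrix (pastRows Tini Tf m p) id).rank = n + m * (Tini + Tf) ∧
    ∀ b : ((Fin (Tini + Tf) × Fin m) ⊕ (Fin Tini × Fin p)) → ℝ,
      euclNorm
        ((Uh.submatrix (futureRows Tini Tf m p) id *
            pinv (Uh.submatrix (pastRows Tini Tf m p) id)).mulVec b -
         (U.submatrix (futureRows Tini Tf m p) id *
            pinv (U.submatrix (pastRows Tini Tf m p) id)).mulVec b)
      ≤ (2 * (1 + Real.sqrt 5) / γ ^ 2 + 1 / γ) * Real.sqrt 2 * κ * euclNorm b := by
  have hγ0 : 0 < γ := hγ ▸ div_pos (lt_min one_pos hβ) hα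
  have h2 : 0 < Real.sqrt 2 := by positivity
  have hF : frobNorm (U * Uᵀ - Uh * Uhᵀ) = Real.sqrt 2 * κ := by
    rw [hκdef]
    field_simp
  have hM : ∀ x, γ * euclNorm x ≤ euclNorm (U.submatrix (pastRows Tini Tf m p) id *ᵥ x) := by
    intro x
    obtain ⟨z, hz⟩ : U.mulVecLin x ∈ LinearMap.range (phiMat A B C D (Tini + Tf)).mulVecLin :=
      hUrange ▸ LinearMap.mem_range_self _ x
    simp only [mulVecLin_apply] at hz
    have hxz : euclNorm x ≤ α * euclNorm z := by
      rw [← euclNorm_mulVec_of_orthonormal hUorth x, ← hz]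
      exact (euclNorm_mulVec_le_specNorm _ z).trans
        (mul_le_mul_of_nonneg_right hαbound (euclNorm_nonneg z))
    calc γ * euclNorm x ≤ γ * (α * euclNorm z) := by gcongr
      _ = min 1 β * euclNorm z := by rw [hγ]; field_simp
      _ ≤ euclNorm ((phiMat A B C D (Tini + Tf) *ᵥ z) ∘ pastRows Tini Tf m p) :=
        le_euclNorm_phiMat_past A B C D hβ hβbound z
      _ = _ := by rw [hz]; rfl
  have hε : frobNorm (U * Uᵀ - Uh * Uhᵀ) ≤ γ / 2 := by
    rw [hF]
    rw [le_div_iff₀ (by positivity)] at hκ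
    linarith
  have : Nonempty (Fin (n + m * (Tini + Tf))) := ⟨⟨0, by omega⟩⟩
  obtain ⟨hr, hrh, hb⟩ := predictor_perturbation pastRows_injective futureRows_injective
    hUorth hUhorth hγ0 hM hε
  rw [Fintype.card_fin] at hr hrh
  refine ⟨hr, hrh, fun b => (hb b).trans ?_⟩
  have hκ0 : 0 ≤ Real.sqrt 2 * κ := hF ▸ Real.sqrt_nonneg _
  have h5 : (2 : ℝ) ≤ Real.sqrt 5 := Real.le_sqrt_of_sq_le (by norm_num)
  rw [hF, mul_assoc _ (Real.sqrt 2) κ]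
  apply mul_le_mul_of_nonneg_right _ (euclNorm_nonneg b)
  apply mul_le_mul_of_nonneg_right _ hκ0
  gcongr
  linarith
end

section
/- Let n, m, p be positive integers and L ≥ n. Let A ∈ ℝ^{n×n}, B ∈ ℝ^{n×m}, C ∈ ℝ^{p×n}, D ∈ ℝ^{p×m}, and let Φ_L = [[0_{mL×n}, I_{mL}], [O_L, T_L]] be the trajectory generation matrix. Then there exists β > 0 such that ‖Φ_L·x‖₂ ≥ β·‖x‖₂ for all x ∈ ℝ^{n+mL} (equivalently, Φ_L has full column rank n + mL) if and only if the extended observability matrix O_L has rank n. -/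
open Matrix BigOperators

lemma euclNorm_eq_norm_toLp {ι : Type*} [Fintype ι] (v : ι → ℝ) :
    euclNorm v = ‖WithLp.toLp 2 v‖ := by
  simp [euclNorm, EuclideanSpace.norm_eq]

lemma exists_pos_mul_euclNorm_le_iff_mulVec_injective {ι κ : Type*} [Fintype ι] [Fintype κ]
    (M : Matrix ι κ ℝ) :
    (∃ β : ℝ, 0 < β ∧ ∀ x : κ → ℝ, β * euclNorm x ≤ euclNorm (M.mulVec x)) ↔
      Function.Injective M.mulVec := by
  classical
  simp only [euclNorm_eq_norm_toLp]
  constructor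
  · rintro ⟨β, hβ, h⟩
    refine (injective_iff_map_eq_zero M.mulVecLin).2 fun x hx => ?_
    have hle := h x
    rw [← Matrix.mulVecLin_apply, hx, WithLp.toLp_zero, norm_zero] at hle
    have hnorm : ‖WithLp.toLp 2 x‖ = 0 :=
      le_antisymm (nonpos_of_mul_nonpos_right hle hβ) (norm_nonneg _)
    simpa using hnorm
  · intro hM
    have hker : LinearMap.ker (Matrix.toEuclideanLin M) = ⊥ := by
      refine LinearMap.ker_eq_bot.2 fun x y hxy => ?_
      exact WithLp.ofLp_injective 2 (hM (WithLp.toLp_injective 2 hxy))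
    obtain ⟨K, hK, hanti⟩ := LinearMap.exists_antilipschitzWith _ hker
    have hK' : (0 : ℝ) < K := hK
    refine ⟨(K : ℝ)⁻¹, inv_pos.2 hK', fun x => ?_⟩
    rw [inv_mul_le_iff₀ hK']
    exact hanti.le_mul_norm (map_zero _) (WithLp.toLp 2 x)

lemma Matrix.mulVec_injective_iff_rank_eq_card {ι κ K : Type*} [Field K] [Fintype κ]
    (M : Matrix ι κ K) : Function.Injective M.mulVec ↔ M.rank = Fintype.card κ := by
  rw [Matrix.mulVec_injective_iff, linearIndependent_iff_card_eq_finrank_span,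
    Matrix.rank_eq_finrank_span_cols, eq_comm, Set.finrank]

lemma Matrix.fromBlocks_zero_one_mulVec_injective_iff {ι κ μ R : Type*} [Fintype κ] [Fintype μ]
    [DecidableEq μ] [CommRing R] (M : Matrix ι κ R) (N : Matrix ι μ R) :
    Function.Injective (Matrix.fromBlocks (0 : Matrix μ κ R) (1 : Matrix μ μ R) M N).mulVec ↔
      Function.Injective M.mulVec := by
  have hblock (x : κ → R) (u : μ → R) :
      (Matrix.fromBlocks (0 : Matrix μ κ R) (1 : Matrix μ μ R) M N).mulVec
        (Sum.elim x u) = Sum.elim u (M.mulVec x + N.mulVec u) := by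
    simp [Matrix.fromBlocks_mulVec]
  constructor
  · intro h x y hxy
    have heq := @h (Sum.elim x 0) (Sum.elim y 0) (by rw [hblock, hblock, hxy])
    exact (Sum.elim_eq_iff.1 heq).1
  · intro h x y hxy
    rw [← Sum.elim_comp_inl_inr x, ← Sum.elim_comp_inl_inr y] at hxy ⊢
    rw [hblock, hblock, Sum.elim_eq_iff] at hxy
    obtain ⟨hu, hx⟩ := hxy
    rw [hu] at hx ⊢
    rw [h (add_right_cancel hx)]

/-- Proposition of Section 3.1: `Φ_L` has full column rank (equivalently,
its smallest singular value is positive) if and only if `O_L` has rank `n`. -/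
theorem phi_full_column_rank_iff_observable
    (n m p L : ℕ) (hn : 0 < n) (hm : 0 < m) (hp : 0 < p) (hL : n ≤ L)
    (A : Matrix (Fin n) (Fin n) ℝ) (B : Matrix (Fin n) (Fin m) ℝ)
    (C : Matrix (Fin p) (Fin n) ℝ) (D : Matrix (Fin p) (Fin m) ℝ) :
    (∃ β : ℝ, 0 < β ∧ ∀ x : (Fin n ⊕ (Fin L × Fin m)) → ℝ,
        β * euclNorm x ≤ euclNorm ((phiMat A B C D L).mulVec x)) ↔
    (obsMat A C L).rank = n := by
  rw [exists_pos_mul_euclNorm_le_iff_mulVec_injective, phiMat,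
    Matrix.fromBlocks_zero_one_mulVec_injective_iff, Matrix.mulVec_injective_iff_rank_eq_card,
    Fintype.card_fin]
end

section
/- Let U, V ∈ ℝ^{q×r} satisfy UᵀU = VᵀV = I_r. Then there exists an orthogonal matrix R ∈ ℝ^{r×r} (RᵀR = I_r) such that ‖U − V·R‖_F ≤ ‖U·Uᵀ − V·Vᵀ‖_F; equivalently, ‖U − V·R‖_F ≤ √2·d(im U, im V), where d is the chordal distance between the column spaces. Explicitly, if Uᵀ·V = P·Σ·Qᵀ is a singular value decomposition with P, Q orthogonal and Σ diagonal with nonnegative entries, then R = Q·Pᵀ works. -/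
open Matrix BigOperators

/-- A square matrix with pairwise orthogonal columns is an orthogonal matrix times the diagonal
matrix of its column norms. -/
theorem exists_orthogonal_mul_diagonal_of_transpose_mul_self {n : Type*} [Fintype n]
    [DecidableEq n] {N : Matrix n n ℝ} {σ : n → ℝ}
    (hN : Nᵀ * N = diagonal fun i => σ i ^ 2) :
    ∃ P : Matrix n n ℝ, Pᵀ * P = 1 ∧ N = P * diagonal σ := by
  have hcol : ∀ i j, ∑ k, N k i * N k j = if i = j then σ i ^ 2 else 0 := fun i j => by
    have := congrFun (congrFun hN i) j
    simpa [mul_apply, diagonal_apply] using this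
  let v : n → EuclideanSpace ℝ n := fun j => WithLp.toLp 2 fun i => N i j / σ j
  have hv : Orthonormal ℝ ({j | σ j ≠ 0}.domRestrict v) := by
    rw [orthonormal_iff_ite]
    rintro ⟨i, hi⟩ ⟨j, hj⟩
    have hij : inner ℝ (v i) (v j) = (∑ k, N k i * N k j) / (σ i * σ j) := by
      simp only [v, PiLp.inner_apply, Finset.sum_div]
      refine Finset.sum_congr rfl fun k _ => ?_
      simp only [RCLike.inner_apply, conj_trivial]
      ring
    simp only [Set.domRestrict_apply, Subtype.mk.injEq]
    rw [hij, hcol]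
    split_ifs with h
    · subst h
      rw [pow_two, div_self (mul_ne_zero hi hi)]
    · exact zero_div _
  obtain ⟨b, hb⟩ := hv.exists_orthonormalBasis_extension_of_card_eq (by simp)
  refine ⟨of fun i j => b j i, ?_, ?_⟩
  · ext i j
    have := orthonormal_iff_ite.mp b.orthonormal j i
    simpa [mul_apply, one_apply, PiLp.inner_apply, eq_comm] using this
  · ext i j
    rw [mul_diagonal, of_apply]
    by_cases hj : σ j = 0
    · have h := hcol j j
      rw [if_pos rfl, hj, zero_pow two_ne_zero,
        Finset.sum_eq_zero_iff_of_nonneg fun k _ => mul_self_nonneg _] at h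
      rw [hj, mul_zero]
      exact mul_self_eq_zero.mp (h i (Finset.mem_univ i))
    · rw [hb j hj]
      exact (div_mul_cancel₀ _ hj).symm

/-- Every real square matrix has a singular value decomposition. -/
theorem exists_singular_value_decomposition {n : Type*} [Fintype n] [DecidableEq n]
    (M : Matrix n n ℝ) :
    ∃ (P Q : Matrix n n ℝ) (σ : n → ℝ), Pᵀ * P = 1 ∧ Qᵀ * Q = 1 ∧ (∀ i, 0 ≤ σ i) ∧
      M = P * diagonal σ * Qᵀ := by
  have hpsd : (Mᵀ * M).PosSemidef := by
    simpa [conjTranspose_eq_transpose_of_trivial] using posSemidef_conjTranspose_mul_self M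
  have hA := hpsd.isHermitian
  let Q : Matrix n n ℝ := hA.eigenvectorUnitary
  have hQ : Qᵀ * Q = 1 := by
    simpa [star_eq_conjTranspose, conjTranspose_eq_transpose_of_trivial] using
      Unitary.coe_star_mul_self hA.eigenvectorUnitary
  have hspec : Mᵀ * M = Q * diagonal hA.eigenvalues * Qᵀ := by
    have h := hA.spectral_theorem
    rw [Unitary.conjStarAlgAut_apply] at h
    simpa [star_eq_conjTranspose, conjTranspose_eq_transpose_of_trivial] using h
  have hN : (M * Q)ᵀ * (M * Q) = diagonal fun i => √(hA.eigenvalues i) ^ 2 := by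
    have hsq : (fun i => √(hA.eigenvalues i) ^ 2) = hA.eigenvalues :=
      funext fun i => Real.sq_sqrt (hpsd.eigenvalues_nonneg i)
    calc (M * Q)ᵀ * (M * Q) = Qᵀ * (Mᵀ * M) * Q := by
          simp only [transpose_mul, Matrix.mul_assoc]
      _ = (Qᵀ * Q) * diagonal hA.eigenvalues * (Qᵀ * Q) := by
          simp only [congrArg (Qᵀ * · * Q) hspec, Matrix.mul_assoc]
      _ = _ := by rw [hQ, Matrix.one_mul, Matrix.mul_one, hsq]
  obtain ⟨P, hP, hMQ⟩ := exists_orthogonal_mul_diagonal_of_transpose_mul_self hN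
  refine ⟨P, Q, fun i => √(hA.eigenvalues i), hP, hQ, fun i => Real.sqrt_nonneg _, ?_⟩
  rw [← hMQ, Matrix.mul_assoc, mul_eq_one_comm.mp hQ, Matrix.mul_one]

theorem frobNorm_eq_sqrt_trace {ι κ : Type*} [Fintype ι] [Fintype κ] (M : Matrix ι κ ℝ) :
    frobNorm M = √(Mᵀ * M).trace := by
  simp only [frobNorm, trace, diag_apply, mul_apply, transpose_apply, ← pow_two]
  rw [Finset.sum_comm]

/-- Orthonormal bases `A`, `B` consisting of principal vectors are at Frobenius distance at most
that of the orthogonal projections. -/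
theorem frobNorm_sub_le_of_transpose_mul_eq_diagonal {m n : Type*} [Fintype m] [Fintype n]
    [DecidableEq n] {A B : Matrix m n ℝ} {σ : n → ℝ} (hA : Aᵀ * A = 1) (hB : Bᵀ * B = 1)
    (hσ : ∀ i, 0 ≤ σ i) (hAB : Aᵀ * B = diagonal σ) :
    frobNorm (A - B) ≤ frobNorm (A * Aᵀ - B * Bᵀ) := by
  have hBA : Bᵀ * A = diagonal σ := by
    simpa using congrArg transpose hAB
  have hsub : (A - B)ᵀ * (A - B) = diagonal fun i => 2 - 2 * σ i := by
    rw [transpose_sub, Matrix.sub_mul, Matrix.mul_sub, Matrix.mul_sub, hA, hB, hAB, hBA,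
      ← diagonal_one, diagonal_sub, diagonal_sub, diagonal_sub]
    congr 1
    ext i
    ring
  have hσ_le : ∀ i, σ i ≤ 1 := fun i => by
    have h := congrFun (congrFun hsub i) i
    rw [diagonal_apply_eq, mul_apply] at h
    have : 0 ≤ ∑ k, (A - B)ᵀ i k * (A - B) k i :=
      Finset.sum_nonneg fun k _ => mul_self_nonneg _
    linarith
  have hproj : ((A * Aᵀ - B * Bᵀ)ᵀ * (A * Aᵀ - B * Bᵀ)).trace = ∑ i, (2 - 2 * σ i ^ 2) := by
    have key : ∀ C D : Matrix m n ℝ,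
        (C * Cᵀ * (D * Dᵀ)).trace = ((Cᵀ * D) * (Dᵀ * C)).trace := fun C D => by
      rw [Matrix.mul_assoc, trace_mul_comm]
      simp only [Matrix.mul_assoc]
    rw [transpose_sub, transpose_mul, transpose_mul, transpose_transpose, transpose_transpose,
      Matrix.sub_mul, Matrix.mul_sub, Matrix.mul_sub, trace_sub, trace_sub, trace_sub,
      key, key, key, key, hA, hB, hAB, hBA, ← diagonal_one, diagonal_mul_diagonal,
      diagonal_mul_diagonal, trace_diagonal, trace_diagonal, ← Finset.sum_sub_distrib,
      ← Finset.sum_sub_distrib, ← Finset.sum_sub_distrib]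
    exact Finset.sum_congr rfl fun i _ => by ring
  rw [frobNorm_eq_sqrt_trace, frobNorm_eq_sqrt_trace, hsub, hproj, trace_diagonal]
  refine Real.sqrt_le_sqrt (Finset.sum_le_sum fun i _ => ?_)
  nlinarith [hσ i, hσ_le i]

theorem frobNorm_mul_of_mul_transpose_eq_one {m n : Type*} [Fintype m] [Fintype n]
    [DecidableEq n] (A : Matrix m n ℝ) {P : Matrix n n ℝ} (hP : P * Pᵀ = 1) :
    frobNorm (A * P) = frobNorm A := by
  rw [frobNorm_eq_sqrt_trace, frobNorm_eq_sqrt_trace, transpose_mul, Matrix.mul_assoc,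
    trace_mul_comm, ← Matrix.mul_assoc, Matrix.mul_assoc, Matrix.mul_assoc, hP, Matrix.mul_one]

/-- final inequality of Lemma 3: after optimal alignment, the Frobenius
distance between orthonormal bases is bounded by `‖UUᵀ − VVᵀ‖_F = √2·d(im U, im V)`;
explicitly, if `Uᵀ·V = P·Σ·Qᵀ` is an SVD, then `R = Q·Pᵀ` works. -/
theorem aligned_basis_frob_le_chordal
    (q r : ℕ) (U V : Matrix (Fin q) (Fin r) ℝ)
    (hU : Uᵀ * U = 1) (hV : Vᵀ * V = 1) :
    (∃ R : Matrix (Fin r) (Fin r) ℝ, Rᵀ * R = 1 ∧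
      frobNorm (U - V * R) ≤ frobNorm (U * Uᵀ - V * Vᵀ) ∧
      frobNorm (U - V * R) ≤ Real.sqrt 2 * ((1 / Real.sqrt 2) * frobNorm (U * Uᵀ - V * Vᵀ))) ∧
    ∀ (P Q : Matrix (Fin r) (Fin r) ℝ) (σ : Fin r → ℝ),
      Pᵀ * P = 1 → Qᵀ * Q = 1 → (∀ i, 0 ≤ σ i) →
      Uᵀ * V = P * Matrix.diagonal σ * Qᵀ →
      frobNorm (U - V * (Q * Pᵀ)) ≤ frobNorm (U * Uᵀ - V * Vᵀ) := by
  have explicit : ∀ (P Q : Matrix (Fin r) (Fin r) ℝ) (σ : Fin r → ℝ),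
      Pᵀ * P = 1 → Qᵀ * Q = 1 → (∀ i, 0 ≤ σ i) →
      Uᵀ * V = P * Matrix.diagonal σ * Qᵀ →
      frobNorm (U - V * (Q * Pᵀ)) ≤ frobNorm (U * Uᵀ - V * Vᵀ) := by
    intro P Q σ hP hQ hσ hUV
    have orth : ∀ {W : Matrix (Fin q) (Fin r) ℝ} {O : Matrix (Fin r) (Fin r) ℝ},
        Wᵀ * W = 1 → Oᵀ * O = 1 →
        (W * O)ᵀ * (W * O) = 1 ∧ (W * O) * (W * O)ᵀ = W * Wᵀ := fun {W O} hW hO => by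
      constructor
      · rw [transpose_mul, Matrix.mul_assoc, ← Matrix.mul_assoc Wᵀ, hW, Matrix.one_mul, hO]
      · rw [transpose_mul, Matrix.mul_assoc, ← Matrix.mul_assoc O, mul_eq_one_comm.mp hO,
          Matrix.one_mul]
    have hdiag : (U * P)ᵀ * (V * Q) = diagonal σ := by
      calc (U * P)ᵀ * (V * Q) = Pᵀ * (Uᵀ * V) * Q := by
            simp only [transpose_mul, Matrix.mul_assoc]
        _ = (Pᵀ * P) * diagonal σ * (Qᵀ * Q) := by rw [hUV]; simp only [Matrix.mul_assoc]
        _ = diagonal σ := by rw [hP, hQ, Matrix.one_mul, Matrix.mul_one]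
    have hrot : (U - V * (Q * Pᵀ)) * P = U * P - V * Q := by
      rw [Matrix.sub_mul, Matrix.mul_assoc V, Matrix.mul_assoc Q, hP, Matrix.mul_one]
    rw [← frobNorm_mul_of_mul_transpose_eq_one _ (mul_eq_one_comm.mp hP), hrot,
      ← (orth hU hP).2, ← (orth hV hQ).2]
    exact frobNorm_sub_le_of_transpose_mul_eq_diagonal (orth hU hP).1 (orth hV hQ).1 hσ hdiag
  refine ⟨?_, explicit⟩
  obtain ⟨P, Q, σ, hP, hQ, hσ, hUV⟩ := exists_singular_value_decomposition (Uᵀ * V)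
  have hle := explicit P Q σ hP hQ hσ hUV
  refine ⟨Q * Pᵀ, ?_, hle, ?_⟩
  · rw [transpose_mul, transpose_transpose, Matrix.mul_assoc, ← Matrix.mul_assoc Qᵀ, hQ,
      Matrix.one_mul, mul_eq_one_comm.mp hP]
  · rwa [← mul_assoc, mul_one_div_cancel (by positivity), one_mul]
end

section
/- Let n, m, p be positive integers and L ≥ n. Let A ∈ ℝ^{n×n}, B ∈ ℝ^{n×m}, C ∈ ℝ^{p×n}, D ∈ ℝ^{p×m}, assume (A, B) is controllable (the matrix [B, A·B, …, A^{n−1}·B] ∈ ℝ^{n×nm} has rank n), and assume (A, C) is observable (the extended observability matrix O_n ∈ ℝ^{pn×n} has rank n). Then the restricted behavior B_{[0,L−1]} is a linear subspace of ℝ^{(m+p)L} of dimension mL + n; that is, there is a linear subspace (submodule) of ℝ^{(m+p)L} whose underlying set equals B_{[0,L−1]} and whose dimension is mL + n. -/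
open Matrix BigOperators


/-- Controllability matrix `[B, A·B, …, A^{n−1}·B]`. -/
noncomputable def ctrbMat {n m : ℕ} (A : Matrix (Fin n) (Fin n) ℝ)
    (B : Matrix (Fin n) (Fin m) ℝ) : Matrix (Fin n) (Fin n × Fin m) ℝ :=
  fun i kj => (A ^ (kj.1 : ℕ) * B) i kj.2

/-- The restricted behavior `B_{[0,L−1]}` of the LTI system `(A, B, C, D)`: the set of
stacked input–output sequences of length `L` admitting a compatible state sequence. -/
def behaviorSet {n m p : ℕ} (A : Matrix (Fin n) (Fin n) ℝ) (B : Matrix (Fin n) (Fin m) ℝ)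
    (C : Matrix (Fin p) (Fin n) ℝ) (D : Matrix (Fin p) (Fin m) ℝ) (L : ℕ) :
    Set (((Fin L × Fin m) ⊕ (Fin L × Fin p)) → ℝ) :=
  {w | ∃ x : ℕ → Fin n → ℝ, ∀ t : Fin L,
    x ((t : ℕ) + 1) = A.mulVec (x (t : ℕ)) + B.mulVec (fun i => w (Sum.inl (t, i))) ∧
    (fun j => w (Sum.inr (t, j))) =
      C.mulVec (x (t : ℕ)) + D.mulVec (fun i => w (Sum.inl (t, i)))}

/-- The state at time `t`, as a linear function of the initial state and of the stacked inputs
on `[0, L-1]`; the input vanishes from time `L` on. -/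
noncomputable def stateMap {n m : ℕ} (A : Matrix (Fin n) (Fin n) ℝ)
    (B : Matrix (Fin n) (Fin m) ℝ) (L : ℕ) :
    ℕ → ((Fin n → ℝ) × (Fin L × Fin m → ℝ)) →ₗ[ℝ] (Fin n → ℝ)
  | 0 => LinearMap.fst ℝ _ _
  | t + 1 => A.mulVecLin ∘ₗ stateMap A B L t +
      if h : t < L then
        B.mulVecLin ∘ₗ LinearMap.funLeft ℝ ℝ (fun i => (⟨t, h⟩, i)) ∘ₗ LinearMap.snd ℝ _ _
      else 0

/-- The input-output trajectory generated by an initial state and stacked inputs. -/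
noncomputable def trajectoryMap {n m p : ℕ} (A : Matrix (Fin n) (Fin n) ℝ)
    (B : Matrix (Fin n) (Fin m) ℝ) (C : Matrix (Fin p) (Fin n) ℝ)
    (D : Matrix (Fin p) (Fin m) ℝ) (L : ℕ) :
    ((Fin n → ℝ) × (Fin L × Fin m → ℝ)) →ₗ[ℝ] ((Fin L × Fin m) ⊕ (Fin L × Fin p) → ℝ) :=
  LinearMap.pi (Sum.elim
    (fun tj => LinearMap.proj tj ∘ₗ LinearMap.snd ℝ _ _)
    (fun tj => LinearMap.proj tj.2 ∘ₗ (C.mulVecLin ∘ₗ stateMap A B L tj.1 +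
      D.mulVecLin ∘ₗ LinearMap.funLeft ℝ ℝ (fun i => (tj.1, i)) ∘ₗ LinearMap.snd ℝ _ _)))

section

variable {n m p : ℕ} (A : Matrix (Fin n) (Fin n) ℝ) (B : Matrix (Fin n) (Fin m) ℝ)
  (C : Matrix (Fin p) (Fin n) ℝ) (D : Matrix (Fin p) (Fin m) ℝ) (L : ℕ)

lemma stateMap_zero (z : (Fin n → ℝ) × (Fin L × Fin m → ℝ)) : stateMap A B L 0 z = z.1 := rfl

lemma stateMap_succ (t : Fin L) (z : (Fin n → ℝ) × (Fin L × Fin m → ℝ)) :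
    stateMap A B L (t + 1) z = A *ᵥ stateMap A B L t z + B *ᵥ fun i => z.2 (t, i) := by
  simp only [stateMap, t.isLt, dif_pos]
  rfl

lemma trajectoryMap_inl (z : (Fin n → ℝ) × (Fin L × Fin m → ℝ)) (tj : Fin L × Fin m) :
    trajectoryMap A B C D L z (Sum.inl tj) = z.2 tj := rfl

lemma trajectoryMap_inr (z : (Fin n → ℝ) × (Fin L × Fin m → ℝ)) (t : Fin L) (j : Fin p) :
    trajectoryMap A B C D L z (Sum.inr (t, j)) =
      (C *ᵥ stateMap A B L t z + D *ᵥ fun i => z.2 (t, i)) j := rfl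

lemma range_trajectoryMap :
    ((trajectoryMap A B C D L).range : Set ((Fin L × Fin m) ⊕ (Fin L × Fin p) → ℝ)) =
      behaviorSet A B C D L := by
  ext w
  constructor
  · rintro ⟨z, rfl⟩
    exact ⟨fun t => stateMap A B L t z, fun t => ⟨stateMap_succ A B L t z, rfl⟩⟩
  · rintro ⟨x, hx⟩
    have hstate : ∀ t ≤ L, stateMap A B L t (x 0, fun tj => w (Sum.inl tj)) = x t := by
      intro t
      induction t with
      | zero => exact fun _ => rfl
      | succ t ih =>
        intro ht
        rw [stateMap_succ A B L ⟨t, ht⟩, ih (Nat.le_of_succ_le ht), (hx ⟨t, ht⟩).1]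
    refine ⟨(x 0, fun tj => w (Sum.inl tj)), funext ?_⟩
    rintro (tj | ⟨t, j⟩)
    · rfl
    · rw [trajectoryMap_inr, hstate t t.isLt.le]
      exact (congrFun (hx t).2 j).symm

lemma stateMap_zero_input (x : Fin n → ℝ) {t : ℕ} (ht : t ≤ L) :
    stateMap A B L t (x, 0) = (A ^ t) *ᵥ x := by
  induction t with
  | zero => simp [stateMap_zero]
  | succ t ih =>
    rw [stateMap_succ A B L ⟨t, ht⟩, ih (Nat.le_of_succ_le ht), pow_succ', ← mulVec_mulVec]
    have h : (fun i : Fin m => ((x, 0) : (Fin n → ℝ) × (Fin L × Fin m → ℝ)).2 (⟨t, ht⟩, i)) = 0 :=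
      rfl
    rw [h, mulVec_zero, add_zero]

lemma obsMat_mulVec (x : Fin n → ℝ) (t : Fin L) (j : Fin p) :
    (obsMat A C L *ᵥ x) (t, j) = (C *ᵥ (A ^ (t : ℕ)) *ᵥ x) j := by
  rw [mulVec_mulVec]
  rfl

lemma mulVec_injective_of_rank_eq {ι : Type*} [Fintype ι] (M : Matrix ι (Fin n) ℝ)
    (hM : M.rank = n) : Function.Injective M.mulVec := by
  have h := M.mulVecLin.finrank_range_add_finrank_ker
  rw [Module.finrank_fin_fun, ← Matrix.rank, hM] at h
  have hker : Module.finrank ℝ M.mulVecLin.ker = 0 := by omega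
  exact LinearMap.ker_eq_bot.mp (Submodule.finrank_eq_zero.mp hker)

lemma trajectoryMap_injective (hL : n ≤ L) (hobs : (obsMat A C n).rank = n) :
    Function.Injective (trajectoryMap A B C D L) := by
  rw [injective_iff_map_eq_zero]
  rintro ⟨x, u⟩ hz
  obtain rfl : u = 0 := funext fun tj => congrFun hz (Sum.inl tj)
  have hx : obsMat A C n *ᵥ x = obsMat A C n *ᵥ 0 := by
    rw [mulVec_zero]
    ext ⟨t, j⟩
    have ht := congrFun hz (Sum.inr (t.castLE hL, j))
    rw [trajectoryMap_inr, stateMap_zero_input A B L x (t.castLE hL).isLt.le] at ht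
    have h : (fun i : Fin m =>
        ((x, 0) : (Fin n → ℝ) × (Fin L × Fin m → ℝ)).2 (t.castLE hL, i)) = 0 := rfl
    rw [h, mulVec_zero, add_zero] at ht
    rw [obsMat_mulVec]
    exact ht
  rw [mulVec_injective_of_rank_eq _ hobs hx]
  rfl

end

/-- first part of Lemma 1 of the paper: for a controllable and observable
system and `L ≥ n`, the restricted behavior `B_{[0,L−1]}` is a linear subspace of
`ℝ^{(m+p)L}` of dimension `mL + n`. -/
theorem restricted_behavior_is_subspace_of_dim
    (n m p L : ℕ) (hn : 0 < n) (hm : 0 < m) (hp : 0 < p) (hL : n ≤ L)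
    (A : Matrix (Fin n) (Fin n) ℝ) (B : Matrix (Fin n) (Fin m) ℝ)
    (C : Matrix (Fin p) (Fin n) ℝ) (D : Matrix (Fin p) (Fin m) ℝ)
    (hctrb : (ctrbMat A B).rank = n)
    (hobs : (obsMat A C n).rank = n) :
    ∃ S : Submodule ℝ (((Fin L × Fin m) ⊕ (Fin L × Fin p)) → ℝ),
      (S : Set (((Fin L × Fin m) ⊕ (Fin L × Fin p)) → ℝ)) = behaviorSet A B C D L ∧
      Module.finrank ℝ S = m * L + n := by
  refine ⟨(trajectoryMap A B C D L).range, range_trajectoryMap A B C D L, ?_⟩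
  rw [LinearMap.finrank_range_of_inj (trajectoryMap_injective A B C D L hL hobs)]
  simp [Module.finrank_prod, mul_comm, add_comm]
end

section
/- Let n, m, p be positive integers, L ≥ n, and T ≥ 1 with T ≥ n + L. Let A ∈ ℝ^{n×n}, B ∈ ℝ^{n×m}, C ∈ ℝ^{p×n}, D ∈ ℝ^{p×m}, assume (A, B) is controllable (the matrix [B, A·B, …, A^{n−1}·B] has rank n) and (A, C) is observable (O_n has rank n). Let x(0), …, x(T) ∈ ℝⁿ, u(0), …, u(T−1) ∈ ℝ^m, y(0), …, y(T−1) ∈ ℝ^p satisfy x(t+1) = A·x(t) + B·u(t) and y(t) = C·x(t) + D·u(t) for all t = 0, …, T−1, and suppose u is persistently exciting of order n+L, i.e., the Hankel matrix H_{n+L}(u) ∈ ℝ^{m(n+L)×(T−n−L+1)} with (i,j) block u(i+j) has full row rank m(n+L). Then the column space of the stacked Hankel matrix [H_L(u); H_L(y)] ∈ ℝ^{(m+p)L×(T−L+1)} equals the restricted behavior B_{[0,L−1]}. -/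
open Matrix BigOperators


/-- Hankel matrix of depth `k` of a `d`-dimensional signal over the horizon `[0, T−1]`:
the `(i, j)` block is `z(i + j)`. -/
def hankel {d : ℕ} (k T : ℕ) (z : ℕ → Fin d → ℝ) :
    Matrix (Fin k × Fin d) (Fin (T - k + 1)) ℝ :=
  fun ia c => z ((ia.1 : ℕ) + (c : ℕ)) ia.2

/-- A real matrix of full row rank has trivial left kernel. -/
lemma eq_zero_of_vecMul_eq_zero_of_rank_eq_card {ι κ : Type*} [Fintype ι] [Fintype κ]
    {M : Matrix ι κ ℝ} (hM : M.rank = Fintype.card ι) {v : ι → ℝ} (hv : v ᵥ* M = 0) : v = 0 := by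
  have hli : LinearIndependent ℝ M.row := by
    rw [linearIndependent_iff_card_eq_finrank_span, Set.finrank, ← M.rank_eq_finrank_span_row, hM]
  exact Matrix.vecMul_injective_iff.2 hli (by simpa using hv)

/-- A real matrix with trivial left kernel acts surjectively on column vectors. -/
lemma mulVec_surjective_of_forall_vecMul_eq_zero {ι κ : Type*} [Fintype ι] [Fintype κ]
    {M : Matrix ι κ ℝ} (hM : ∀ v, v ᵥ* M = 0 → v = 0) : Function.Surjective M.mulVec := by
  have hinj : Function.Injective M.vecMul := fun v w h ↦
    sub_eq_zero.1 (hM _ (by rw [Matrix.sub_vecMul]; exact sub_eq_zero.2 h))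
  have hrank : M.rank = Fintype.card ι := (Matrix.vecMul_injective_iff.1 hinj).rank_matrix
  have htop : LinearMap.range M.mulVecLin = ⊤ :=
    Submodule.eq_top_of_finrank_eq (by simpa [Matrix.rank] using hrank)
  exact LinearMap.range_eq_top.1 htop

/-- Persistency of excitation: only the trivial linear combination of `k` consecutive samples
vanishes along the whole horizon. -/
lemma eq_zero_of_hankel_rank {d k T : ℕ} {z : ℕ → Fin d → ℝ}
    (hz : (hankel k T z).rank = d * k) {c : ℕ → Fin d → ℝ}
    (hc : ∀ j ≤ T - k, ∑ i ∈ Finset.range k, c i ⬝ᵥ z (j + i) = 0) {i : ℕ} (hi : i < k) :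
    c i = 0 := by
  have hv : (fun ia : Fin k × Fin d ↦ c ia.1 ia.2) = 0 := by
    refine eq_zero_of_vecMul_eq_zero_of_rank_eq_card (M := hankel k T z) ?_ ?_
    · simpa [mul_comm] using hz
    · ext j
      have := hc j (Nat.lt_succ_iff.1 j.2)
      rw [Finset.sum_range] at this
      simpa [Matrix.vecMul, dotProduct, hankel, Fintype.sum_prod_type, add_comm] using this
  ext a
  exact congrFun hv (⟨i, hi⟩, a)

/-- A left annihilator of the controllability matrix of a controllable pair is zero. -/
lemma eq_zero_of_vecMul_pow_mul_eq_zero {n m : ℕ} {A : Matrix (Fin n) (Fin n) ℝ}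
    {B : Matrix (Fin n) (Fin m) ℝ} (hctrb : (ctrbMat A B).rank = n) {ξ : Fin n → ℝ}
    (hξ : ∀ k < n, ξ ᵥ* (A ^ k * B) = 0) : ξ = 0 := by
  refine eq_zero_of_vecMul_eq_zero_of_rank_eq_card (M := ctrbMat A B) (by simpa using hctrb) ?_
  ext kj
  exact congrFun (hξ kj.1 kj.1.2) kj.2

section Annihilator

variable {n m L T : ℕ} {A : Matrix (Fin n) (Fin n) ℝ} {B : Matrix (Fin n) (Fin m) ℝ}
  {x : ℕ → Fin n → ℝ} {u : ℕ → Fin m → ℝ} {ξ : Fin n → ℝ} {q : ℕ → Fin m → ℝ}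

/-- Shifting an annihilator of the state and input data forward in time by `k` steps. The
coefficients of the inputs are listed in `q`, latest input first. -/
lemma annihilator_shift (hx : ∀ t < T, x (t + 1) = A *ᵥ x t + B *ᵥ u t)
    (hq : ∀ k, q (L + k) = ξ ᵥ* (A ^ k * B))
    (h : ∀ j, j + L ≤ T →
      ξ ⬝ᵥ x j + ∑ i ∈ Finset.range L, q (L - 1 - i) ⬝ᵥ u (j + i) = 0)
    (k j : ℕ) (hj : j + k + L ≤ T) :
    (ξ ᵥ* A ^ k) ⬝ᵥ x j +
      ∑ i ∈ Finset.range (L + k), q (L + k - 1 - i) ⬝ᵥ u (j + i) = 0 := by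
  induction k generalizing j with
  | zero => simpa using h j (by omega)
  | succ k ih =>
    have hs := ih (j + 1) (by omega)
    by_cases hjT : j < T
    · rw [hx j hjT, dotProduct_add, dotProduct_mulVec, dotProduct_mulVec, vecMul_vecMul,
        vecMul_vecMul, ← pow_succ, ← hq] at hs
      rw [← add_assoc L k 1, Finset.sum_range_succ', ← hs]
      have hsum : ∑ i ∈ Finset.range (L + k), q (L + k + 1 - 1 - (i + 1)) ⬝ᵥ u (j + (i + 1)) =
          ∑ i ∈ Finset.range (L + k), q (L + k - 1 - i) ⬝ᵥ u (j + 1 + i) := by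
        refine Finset.sum_congr rfl fun i _ ↦ ?_
        congr 2 <;> omega
      rw [hsum]
      simp only [Nat.add_sub_cancel, Nat.sub_zero, add_zero]
      ring
    · omega

/-- Every annihilator of the state and input data vanishes when the input is persistently
exciting of order `n + L`. -/
lemma annihilator_eq_zero (hTnL : n + L ≤ T)
    (hx : ∀ t < T, x (t + 1) = A *ᵥ x t + B *ᵥ u t)
    (hPE : (hankel (n + L) T u).rank = m * (n + L))
    (hq : ∀ k, q (L + k) = ξ ᵥ* (A ^ k * B))
    (h : ∀ j, j + L ≤ T →
      ξ ⬝ᵥ x j + ∑ i ∈ Finset.range L, q (L - 1 - i) ⬝ᵥ u (j + i) = 0)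
    (r : ℕ) (hr : r < n + L) : q r = 0 := by
  have hdeg : A.charpoly.natDegree = n := by simp [Matrix.charpoly_natDegree_eq_dim]
  have hlead : A.charpoly.coeff n = 1 := by
    simpa [Polynomial.Monic, Polynomial.leadingCoeff, hdeg] using A.charpoly_monic
  have hCH : ∑ k ∈ Finset.range (n + 1), A.charpoly.coeff k • A ^ k = 0 := by
    rw [← A.aeval_self_charpoly, Polynomial.aeval_eq_sum_range, hdeg]
  have hcoeff : ∀ i < n + L, ∑ k ∈ Finset.range (n + 1),
      A.charpoly.coeff k • (if i < L + k then q (L + k - 1 - i) else 0) = 0 := by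
    intro i hi
    refine eq_zero_of_hankel_rank (c := fun i ↦ ∑ k ∈ Finset.range (n + 1),
      A.charpoly.coeff k • (if i < L + k then q (L + k - 1 - i) else 0)) hPE ?_ hi
    intro j hj
    have hstate : ∑ k ∈ Finset.range (n + 1),
        A.charpoly.coeff k * ((ξ ᵥ* A ^ k) ⬝ᵥ x j) = 0 := by
      have := congrArg (fun M ↦ (ξ ᵥ* M) ⬝ᵥ x j) hCH
      simpa [Matrix.vecMul_sum, sum_dotProduct, Matrix.vecMul_smul] using this
    calc
      _ = ∑ k ∈ Finset.range (n + 1), A.charpoly.coeff k *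
          ∑ i ∈ Finset.range (L + k), q (L + k - 1 - i) ⬝ᵥ u (j + i) := by
        simp_rw [sum_dotProduct, smul_dotProduct, smul_eq_mul]
        rw [Finset.sum_comm]
        refine Finset.sum_congr rfl fun k hk ↦ ?_
        rw [← Finset.mul_sum]
        congr 1
        have hsub : Finset.range (L + k) ⊆ Finset.range (n + L) :=
          Finset.range_subset_range.2 (by have := Finset.mem_range.1 hk; omega)
        rw [← Finset.sum_subset hsub]
        · exact Finset.sum_congr rfl fun i hi ↦ by rw [if_pos (Finset.mem_range.1 hi)]
        · intro i _ hi
          rw [if_neg (by simpa using hi), zero_dotProduct]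
      _ = ∑ k ∈ Finset.range (n + 1), A.charpoly.coeff k * ((ξ ᵥ* A ^ k) ⬝ᵥ x j +
          ∑ i ∈ Finset.range (L + k), q (L + k - 1 - i) ⬝ᵥ u (j + i)) := by
        simp_rw [mul_add]
        rw [Finset.sum_add_distrib, hstate, zero_add]
      _ = 0 := Finset.sum_eq_zero fun k hk ↦ by
        have := Finset.mem_range.1 hk
        rw [annihilator_shift hx hq h k j (by omega), mul_zero]
  induction r using Nat.strong_induction_on with
  | _ r ih =>
    have hi := hcoeff (n + L - 1 - r) (by omega)
    rw [Finset.sum_range_succ, hlead, one_smul, if_pos (by omega), Finset.sum_eq_zero, zero_add]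
      at hi
    · rwa [show L + n - 1 - (n + L - 1 - r) = r by omega] at hi
    · intro k hk
      have := Finset.mem_range.1 hk
      split_ifs with hlt
      · rw [ih _ (by omega) (by omega), smul_zero]
      · rw [smul_zero]

end Annihilator

/-- Controllability and persistency of excitation let every pair of an initial state and an input
sequence of length `L` be written as one linear combination of windows of the data. -/
lemma exists_combination_state_input {n m L T : ℕ} {A : Matrix (Fin n) (Fin n) ℝ}
    {B : Matrix (Fin n) (Fin m) ℝ} {x : ℕ → Fin n → ℝ} {u : ℕ → Fin m → ℝ}
    (hTnL : n + L ≤ T) (hctrb : (ctrbMat A B).rank = n)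
    (hx : ∀ t < T, x (t + 1) = A *ᵥ x t + B *ᵥ u t)
    (hPE : (hankel (n + L) T u).rank = m * (n + L))
    (x₀ : Fin n → ℝ) (v : Fin L × Fin m → ℝ) :
    ∃ g : Fin (T - L + 1) → ℝ, ∑ c, g c • x c = x₀ ∧
      ∀ t : Fin L, ∑ c, g c • u (t + c) = fun a ↦ v (t, a) := by
  have hsurj : Function.Surjective (Matrix.fromRows
      (Matrix.of fun (i : Fin n) (c : Fin (T - L + 1)) ↦ x c i) (hankel L T u)).mulVec := by
    refine mulVec_surjective_of_forall_vecMul_eq_zero fun w hw ↦ ?_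
    set ξ : Fin n → ℝ := fun i ↦ w (Sum.inl i) with hξ
    set q : ℕ → Fin m → ℝ := fun s ↦
      if hs : s < L then fun a ↦ w (Sum.inr (⟨L - 1 - s, by omega⟩, a))
      else ξ ᵥ* (A ^ (s - L) * B) with hq
    have hqL : ∀ k, q (L + k) = ξ ᵥ* (A ^ k * B) := fun k ↦ by simp [hq]
    have hq_lt : ∀ i : Fin L, q (L - 1 - i) = fun a ↦ w (Sum.inr (i, a)) := fun i ↦ by
      have hi : L - 1 - (i : ℕ) < L := by omega
      have hi' : (⟨L - 1 - (L - 1 - (i : ℕ)), by omega⟩ : Fin L) = i := Fin.ext (by simp; omega)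
      simp only [hq, dif_pos hi, hi']
    have hzero := annihilator_eq_zero (q := q) hTnL hx hPE hqL fun j hj ↦ by
      have hjc := congrFun hw ⟨j, by omega⟩
      rw [Finset.sum_range]
      simp only [hq_lt]
      simpa [Matrix.vecMul, dotProduct, hankel, Fintype.sum_sum_type, Fintype.sum_prod_type,
        add_comm] using hjc
    have hξ0 : ξ = 0 := eq_zero_of_vecMul_pow_mul_eq_zero hctrb fun k hk ↦ by
      rw [← hqL, hzero _ (by omega)]
    ext (i | ⟨i, a⟩)
    · exact congrFun hξ0 i
    · exact (congrFun (hq_lt i) a).symm.trans (congrFun (hzero _ (by omega)) a)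
  obtain ⟨g, hg⟩ := hsurj (Sum.elim x₀ v)
  refine ⟨g, ?_, fun t ↦ ?_⟩
  · ext i
    simpa [Matrix.mulVec, dotProduct, mul_comm] using congrFun hg (Sum.inl i)
  · ext a
    simpa [Matrix.mulVec, dotProduct, hankel, mul_comm] using congrFun hg (Sum.inr (t, a))

/-- The blocks of a Hankel matrix times a vector are combinations of shifted samples. -/
lemma hankel_mulVec {d : ℕ} (k T : ℕ) (z : ℕ → Fin d → ℝ) (g : Fin (T - k + 1) → ℝ) (t : Fin k) :
    (fun a ↦ (hankel k T z *ᵥ g) (t, a)) = ∑ c, g c • z (t + c) := by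
  ext a
  simp [Matrix.mulVec, dotProduct, hankel, mul_comm]

/-- Linear combinations commute with the map `(x, u) ↦ M x + N u`. -/
lemma sum_smul_mulVec_add {ι α β γ : Type*} [Fintype ι] [Fintype β] [Fintype γ]
    (M : Matrix α β ℝ) (N : Matrix α γ ℝ) (g : ι → ℝ) (x : ι → β → ℝ) (u : ι → γ → ℝ) :
    ∑ c, g c • (M *ᵥ x c + N *ᵥ u c) = M *ᵥ ∑ c, g c • x c + N *ᵥ ∑ c, g c • u c := by
  simp [Matrix.mulVec_sum, Matrix.mulVec_smul, Finset.sum_add_distrib]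

/-- second part of Lemma 1 of the paper, Willems' fundamental lemma:
for a controllable and observable system and persistently exciting input data of order
`n + L`, the column space of the stacked Hankel matrix `[H_L(u); H_L(y)]` equals the
restricted behavior `B_{[0,L−1]}`. -/
theorem fundamental_lemma
    (n m p L T : ℕ) (hn : 0 < n) (hm : 0 < m) (hp : 0 < p) (hL : n ≤ L)
    (hT : 1 ≤ T) (hTnL : n + L ≤ T)
    (A : Matrix (Fin n) (Fin n) ℝ) (B : Matrix (Fin n) (Fin m) ℝ)
    (C : Matrix (Fin p) (Fin n) ℝ) (D : Matrix (Fin p) (Fin m) ℝ)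
    (hctrb : (ctrbMat A B).rank = n)
    (hobs : (obsMat A C n).rank = n)
    (x : ℕ → Fin n → ℝ) (u : ℕ → Fin m → ℝ) (y : ℕ → Fin p → ℝ)
    (hx : ∀ t < T, x (t + 1) = A.mulVec (x t) + B.mulVec (u t))
    (hy : ∀ t < T, y t = C.mulVec (x t) + D.mulVec (u t))
    (hPE : (hankel (n + L) T u).rank = m * (n + L)) :
    (LinearMap.range (Matrix.fromRows (hankel L T u) (hankel L T y)).mulVecLin :
        Set (((Fin L × Fin m) ⊕ (Fin L × Fin p)) → ℝ)) = behaviorSet A B C D L := by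
  have hstate (g : Fin (T - L + 1) → ℝ) (t : ℕ) (ht : t < L) : ∑ c, g c • x (t + 1 + c) =
      A *ᵥ ∑ c, g c • x (t + c) + B *ᵥ ∑ c, g c • u (t + c) := by
    rw [← sum_smul_mulVec_add]
    refine Finset.sum_congr rfl fun c _ ↦ ?_
    rw [← hx _ (by omega), add_right_comm]
  have hout (g : Fin (T - L + 1) → ℝ) (t : ℕ) (ht : t < L) : ∑ c, g c • y (t + c) =
      C *ᵥ ∑ c, g c • x (t + c) + D *ᵥ ∑ c, g c • u (t + c) := by
    rw [← sum_smul_mulVec_add]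
    exact Finset.sum_congr rfl fun c _ ↦ by rw [← hy _ (by omega)]
  ext w
  constructor
  · rintro ⟨g, rfl⟩
    refine ⟨fun t ↦ ∑ c, g c • x (t + c), fun t ↦ ?_⟩
    simp only [Matrix.mulVecLin_apply, Matrix.fromRows_mulVec, Sum.elim_inl, Sum.elim_inr,
      hankel_mulVec]
    exact ⟨hstate g t t.2, hout g t t.2⟩
  · rintro ⟨z, hz⟩
    obtain ⟨g, hg₀, hgu⟩ := exists_combination_state_input hTnL hctrb hx hPE (z 0)
      fun ti ↦ w (Sum.inl ti)
    have hgz (t : ℕ) (ht : t ≤ L) : ∑ c, g c • x (t + c) = z t := by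
      induction t with
      | zero => simpa using hg₀
      | succ t ih =>
        rw [hstate g t ht, ih (by omega), (hz ⟨t, ht⟩).1, ← hgu ⟨t, ht⟩]
    refine ⟨g, ?_⟩
    rw [Matrix.mulVecLin_apply, Matrix.fromRows_mulVec]
    ext (⟨t, a⟩ | ⟨t, a⟩)
    · exact congrFun ((hankel_mulVec L T u g t).trans (hgu t)) a
    · have hyw : ∑ c, g c • y (t + c) = fun a ↦ w (Sum.inr (t, a)) := by
        rw [hout g t t.2, hgz t t.2.le, hgu t]
        exact (hz t).2.symm
      exact congrFun ((hankel_mulVec L T y g t).trans hyw) a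
end
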